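/- Let g be a finite-dimensional Lie algebra over a field of characteristic zero whose Killing form is nondegenerate, equipped with a ℤ-grading g = ⊕_{i=-k}^{k} g_i (⁅g_i, g_j⁆ ⊆ g_{i+j}, g_i = 0 for |i| > k) admitting a grading element E ∈ g with ⁅E, x⁆ = i • x for all x ∈ g_i. Let s : g → g be a Lie algebra automorphism with s(g_i) = g_i for all i. Then for each i, dim {x ∈ g_i : s x = x} = dim {x ∈ g_{-i} : s x = x}. In particular, if s has no nonzero fixed vector in g_- := ⊕_{i<0} g_i, then s has no nonzero fixed vector in p_+ := ⊕_{i>0} g_i. -/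

import Mathlib

/-- If `B` pairs `V` and `W`, separates the points of `W`, and is preserved by the pair `(a, b)`,
then the fixed space of `b` is at most as large as that of `a`. -/
theorem LinearMap.finrank_ker_sub_id_le_of_pairing
    {K V W : Type*} [Field K] [AddCommGroup V] [Module K V] [FiniteDimensional K V]
    [AddCommGroup W] [Module K W]
    (B : V →ₗ[K] W →ₗ[K] K) (hB : ∀ y, (∀ x, B x y = 0) → y = 0)
    (a : V →ₗ[K] V) (b : W →ₗ[K] W) (hab : ∀ x y, B (a x) (b y) = B x y) :
    Module.finrank K (LinearMap.ker (b - LinearMap.id)) ≤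
      Module.finrank K (LinearMap.ker (a - LinearMap.id)) := by
  have hinj : Function.Injective B.flip := by
    rw [← LinearMap.ker_eq_bot, LinearMap.ker_eq_bot']
    intro y hy
    exact hB y fun x => by simpa using LinearMap.congr_fun hy x
  have hmap : (LinearMap.ker (b - LinearMap.id)).map B.flip ≤
      (LinearMap.range (a - LinearMap.id)).dualAnnihilator := by
    rintro _ ⟨y, hy, rfl⟩
    rw [Submodule.mem_dualAnnihilator]
    rintro _ ⟨x, rfl⟩
    have hy' : b y = y := sub_eq_zero.mp hy
    have h := hab x y
    rw [hy'] at h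
    simp [h]
  have h1 := Submodule.finrank_mono hmap
  rw [← (Submodule.equivMapOfInjective B.flip hinj _).finrank_eq] at h1
  have h2 := Subspace.finrank_add_finrank_dualAnnihilator_eq
    (LinearMap.range (a - LinearMap.id))
  have h3 := LinearMap.finrank_range_add_finrank_ker (a - LinearMap.id)
  exact h1.trans_eq (Nat.add_left_cancel (h2.trans h3.symm))

/-- The fixed space of an endomorphism in an invariant subspace is the fixed space of its
restriction. -/
theorem LinearMap.finrank_inf_ker_sub_id
    {K M : Type*} [Field K] [AddCommGroup M] [Module K M]
    (f : M →ₗ[K] M) (p : Submodule K M) (hf : ∀ x ∈ p, f x ∈ p) :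
    Module.finrank K ↥(p ⊓ LinearMap.ker (f - LinearMap.id)) =
      Module.finrank K (LinearMap.ker (f.restrict hf - LinearMap.id)) := by
  have h : LinearMap.ker (f.restrict hf - LinearMap.id) =
      (LinearMap.ker (f - LinearMap.id)).comap p.subtype := by
    ext x
    simp [Subtype.ext_iff]
  rw [h, ← Submodule.map_comap_subtype, Submodule.finrank_map_subtype_eq]

/-- Eigenvectors of `ad E` whose eigenvalues do not sum to zero are orthogonal for the Killing
form. -/
theorem killingForm_eq_zero_of_grading_element
    {K L : Type*} [Field K] [CharZero K] [LieRing L] [LieAlgebra K L]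
    {E x y : L} {i j : ℤ} (hx : ⁅E, x⁆ = i • x) (hy : ⁅E, y⁆ = j • y) (hij : i + j ≠ 0) :
    killingForm K L x y = 0 := by
  have h : killingForm K L ⁅x, E⁆ y = killingForm K L x ⁅E, y⁆ :=
    LieModule.traceForm_apply_lie_apply K L L x E y
  rw [← lie_skew, hx, hy, map_neg, LinearMap.neg_apply, map_zsmul, map_zsmul,
    LinearMap.smul_apply, zsmul_eq_mul, zsmul_eq_mul] at h
  have h' : ((i + j : ℤ) : K) * killingForm K L x y = 0 := by
    push_cast
    linear_combination -h
  exact (mul_eq_zero.mp h').resolve_left (Int.cast_ne_zero.mpr hij)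

/-- For a Lie algebra with nondegenerate Killing form and grading element, the fixed space of a
graded automorphism in the part with degrees in `S` is at most as large as in the part with
degrees in any `T` containing `-S`. -/
theorem finrank_fixed_iSup_le_of_killing
    {K L : Type*} [Field K] [CharZero K] [LieRing L] [LieAlgebra K L] [FiniteDimensional K L]
    (hkilling : ∀ x : L, (∀ y : L, killingForm K L x y = 0) → x = 0)
    (gr : ℤ → Submodule K L) (htop : iSup gr = ⊤)
    (E : L) (hE : ∀ i : ℤ, ∀ x ∈ gr i, ⁅E, x⁆ = i • x)
    (s : L ≃ₗ⁅K⁆ L) (hs : ∀ i : ℤ, ∀ x ∈ gr i, s x ∈ gr i)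
    (S T : Set ℤ) (hST : ∀ i ∈ S, -i ∈ T) :
    Module.finrank K ↥((⨆ i ∈ S, gr i) ⊓
        LinearMap.ker ((s.toLinearEquiv : L →ₗ[K] L) - LinearMap.id)) ≤
      Module.finrank K ↥((⨆ i ∈ T, gr i) ⊓
        LinearMap.ker ((s.toLinearEquiv : L →ₗ[K] L) - LinearMap.id)) := by
  have hinv (U : Set ℤ) : ∀ x ∈ ⨆ i ∈ U, gr i, (s.toLinearEquiv : L →ₗ[K] L) x ∈ ⨆ i ∈ U, gr i := by
    suffices h : (⨆ i ∈ U, gr i) ≤ (⨆ i ∈ U, gr i).comap (s.toLinearEquiv : L →ₗ[K] L) from h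
    exact iSup₂_le fun i hi x hx => le_iSup₂ (f := fun i (_ : i ∈ U) => gr i) i hi (hs i x hx)
  rw [LinearMap.finrank_inf_ker_sub_id _ _ (hinv S), LinearMap.finrank_inf_ker_sub_id _ _ (hinv T)]
  refine LinearMap.finrank_ker_sub_id_le_of_pairing
    ((killingForm K L).domRestrict₁₂ (⨆ i ∈ T, gr i) (⨆ i ∈ S, gr i)) ?_ _ _
    fun x y => LieAlgebra.killingForm_of_equiv_apply s x y
  rintro ⟨y, hy⟩ hxy
  rw [Submodule.mk_eq_zero]
  refine hkilling y fun x => ?_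
  suffices h : iSup gr ≤ LinearMap.ker (killingForm K L y) from h (htop ▸ Submodule.mem_top)
  refine iSup_le fun j x hx => ?_
  rw [LinearMap.mem_ker]
  by_cases hj : j ∈ T
  · rw [LieModule.traceForm_comm]
    exact hxy ⟨x, le_iSup₂ (f := fun i (_ : i ∈ T) => gr i) j hj hx⟩
  · rw [LieModule.traceForm_comm]
    suffices h : (⨆ i ∈ S, gr i) ≤ LinearMap.ker (killingForm K L x) from h hy
    refine iSup₂_le fun i hi z hz => ?_
    refine killingForm_eq_zero_of_grading_element (hE j x hx) (hE i z hz) fun hji => hj ?_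
    rw [eq_neg_of_add_eq_zero_left hji]
    exact hST i hi

/-- Let `g` be a finite-dimensional Lie algebra over a field of
characteristic zero with nondegenerate Killing form, equipped with a `ℤ`-grading
`g = ⊕_{i=-n}^{n} g_i` admitting a grading element `E`, and let `s` be a Lie algebra
automorphism of `g` preserving the grading.  Then for each `i` the fixed spaces of `s`
in `g_i` and `g_{-i}` have the same dimension; in particular, if `s` has no nonzero
fixed vector in `g_- = ⊕_{i<0} g_i`, then it has no nonzero fixed vector in
`p_+ = ⊕_{i>0} g_i`. -/
theorem fixed_space_dim_symmetric_of_killing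
    {𝕜 : Type*} [Field 𝕜] [CharZero 𝕜]
    {g : Type*} [LieRing g] [LieAlgebra 𝕜 g] [FiniteDimensional 𝕜 g]
    (hkilling : ∀ x : g, (∀ y : g, killingForm 𝕜 g x y = 0) → x = 0)
    (n : ℕ) (gr : ℤ → Submodule 𝕜 g)
    (hinternal : DirectSum.IsInternal gr)
    (hbracket : ∀ i j : ℤ, ∀ x ∈ gr i, ∀ y ∈ gr j, ⁅x, y⁆ ∈ gr (i + j))
    (hbound : ∀ i : ℤ, (n : ℤ) < |i| → gr i = ⊥)
    (E : g) (hE : ∀ i : ℤ, ∀ x ∈ gr i, ⁅E, x⁆ = i • x)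
    (s : g ≃ₗ⁅𝕜⁆ g)
    (hs : ∀ i : ℤ, ∀ x ∈ gr i, s x ∈ gr i) :
    (∀ i : ℤ,
      Module.finrank 𝕜
        ↥(gr i ⊓ LinearMap.ker ((s.toLinearEquiv : g →ₗ[𝕜] g) - LinearMap.id)) =
      Module.finrank 𝕜
        ↥(gr (-i) ⊓ LinearMap.ker ((s.toLinearEquiv : g →ₗ[𝕜] g) - LinearMap.id))) ∧
    ((∀ x ∈ ⨆ i ∈ Set.Iio (0 : ℤ), gr i, s x = x → x = 0) →
      ∀ x ∈ ⨆ i ∈ Set.Ioi (0 : ℤ), gr i, s x = x → x = 0) := by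
  have htop := hinternal.submodule_iSup_eq_top
  have key := finrank_fixed_iSup_le_of_killing hkilling gr htop E hE s hs
  refine ⟨fun i => ?_, ?_⟩
  · have h₁ := key {i} {-i} (by simp)
    have h₂ := key {-i} {i} (by simp)
    rw [iSup_singleton, iSup_singleton] at h₁ h₂
    exact le_antisymm h₁ h₂
  intro hneg x hx hsx
  have h := key (Set.Ioi 0) (Set.Iio 0) (by simp)
  have hbot : (⨆ i ∈ Set.Iio (0 : ℤ), gr i) ⊓
      LinearMap.ker ((s.toLinearEquiv : g →ₗ[𝕜] g) - LinearMap.id) = ⊥ :=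
    (Submodule.eq_bot_iff _).mpr fun y hy => hneg y hy.1 (sub_eq_zero.mp hy.2)
  rw [hbot, finrank_bot, Nat.le_zero, Submodule.finrank_eq_zero] at h
  exact (Submodule.eq_bot_iff _).mp h x ⟨hx, sub_eq_zero.mpr hsx⟩
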